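/- Vanishing of the Euler characteristic for homogeneity h = 0: let n ≥ 1 and let w be any integer. Let K be the (finite) set of finitely supported functions k : ℕ → ℕ such that k 0 = 0, k j ≤ C(n−1+j, j) for every j ≥ 1, and Σ_j (j−2)·(k j) = w (an equation of integers). Then Σ_{k ∈ K} (−1)^{Σ_j k j} · Π_j C( C(n−1+j, j), k j ) = 0 in ℤ. In cohomological terms: for a 0-homogeneous Poisson structure on ℝⁿ the weight-w Euler characteristic Σ_m (−1)^m dim C̄ᵐ_w is zero for every weight w; in particular it is independent of w. -/

import Mathlib

theorem finsupp_eq_zero_of_weight_lt {k : ℕ →₀ ℕ} {n : ℕ} {w : ℤ} (h0 : k 0 = 0) (h1 : k 1 ≤ n)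
    (hw : (k.sum fun j v => ((j : ℤ) - 2) * v) = w) {j : ℕ} (hj : (w + n).toNat + 3 ≤ j) :
    k j = 0 := by
  by_contra hne
  have hsum : ∑ i ∈ insert 1 k.support,
      (((i : ℤ) - 2) * k i + if i = 1 then (n : ℤ) else 0) = w + n := by
    rw [Finset.sum_add_distrib, Finset.sum_ite_eq' _ 1, if_pos (Finset.mem_insert_self _ _), ← hw,
      Finsupp.sum_of_support_subset k (Finset.subset_insert 1 k.support) _ (by simp)]
  have hle : ((j : ℤ) - 2) * k j + (if j = 1 then (n : ℤ) else 0) ≤ w + n := by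
    rw [← hsum]
    refine Finset.single_le_sum
      (f := fun i : ℕ => ((i : ℤ) - 2) * k i + if i = 1 then (n : ℤ) else 0)
      (fun i _ => ?_) (by simp [hne])
    rcases i with _ | _ | i
    · simp [h0]
    · simp only [zero_add, if_true]
      push_cast
      linarith [(Nat.cast_le (α := ℤ)).2 h1]
    · have : (0 : ℤ) ≤ i * k (i + 1 + 1) := by positivity
      simpa using (by push_cast; linarith :
        (0 : ℤ) ≤ (((i + 1 + 1 : ℕ) : ℤ) - 2) * k (i + 1 + 1))
  rw [if_neg (by omega)] at hle
  have hk : (1 : ℤ) ≤ k j := by exact_mod_cast Nat.one_le_iff_ne_zero.2 hne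
  have hj2 : (w + n) < (j : ℤ) - 2 := by omega
  nlinarith [show (0 : ℤ) ≤ (j : ℤ) - 2 by omega]

theorem finite_bounded_finsupp_of_weight (n : ℕ) (hn : 1 ≤ n) (w : ℤ) :
    {k : ℕ →₀ ℕ | k 0 = 0 ∧ (∀ j, 1 ≤ j → k j ≤ Nat.choose (n - 1 + j) j) ∧
        (k.sum fun j v => ((j : ℤ) - 2) * v) = w}.Finite := by
  refine (Set.finite_Iic (Finsupp.indicator (Finset.range ((w + n).toNat + 3))
    fun j _ => Nat.choose (n - 1 + j) j)).subset ?_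
  rintro k ⟨h0, hd, hw⟩ j
  have h1 : k 1 ≤ n := by simpa [Nat.sub_add_cancel hn] using hd 1 le_rfl
  by_cases hj : j < (w + n).toNat + 3
  · rw [Finsupp.indicator_of_mem (Finset.mem_range.2 hj)]
    rcases Nat.eq_zero_or_pos j with rfl | hpos
    · simp [h0]
    · exact hd j hpos
  · rw [finsupp_eq_zero_of_weight_lt h0 h1 hw (not_lt.1 hj)]
    exact Nat.zero_le _

/-- A signed sum over finitely supported functions vanishes when one coordinate `a` ranges freely
over `{0, …, d a}` with `d a ≠ 0`. -/
theorem sum_neg_one_pow_mul_prod_choose_eq_zero {ι : Type*} [DecidableEq ι] (K : Finset (ι →₀ ℕ))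
    (d : ι → ℕ) (a : ι) (ha : d a ≠ 0) (hle : ∀ k ∈ K, k a ≤ d a)
    (hK : ∀ k ∈ K, ∀ v ≤ d a, k.update a v ∈ K) :
    ∑ k ∈ K, (-1 : ℤ) ^ (k.sum fun _ v => v) *
      (k.prod fun j v => (Nat.choose (d j) v : ℤ)) = 0 := by
  have hbij : ∑ k ∈ K, (-1 : ℤ) ^ (k.sum fun _ v => v) *
      (k.prod fun j v => (Nat.choose (d j) v : ℤ)) =
      ∑ p ∈ (K.filter fun k => k a = 0) ×ˢ Finset.range (d a + 1),
        ((-1 : ℤ) ^ (p.1.sum fun _ v => v) * (p.1.prod fun j v => (Nat.choose (d j) v : ℤ))) *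
          ((-1) ^ p.2 * (Nat.choose (d a) p.2 : ℤ)) := by
    refine Finset.sum_bij' (fun k _ => (k.erase a, k a)) (fun p _ => p.1.update a p.2)
      ?_ ?_ ?_ ?_ ?_
    · intro k hk
      have := hK k hk 0 (Nat.zero_le _)
      rw [Finsupp.update_eq_erase_add_single, Finsupp.single_zero, add_zero] at this
      simpa [this, Nat.lt_succ_iff] using hle k hk
    · rintro ⟨b, v⟩ hp
      simp only [Finset.mem_product, Finset.mem_filter, Finset.mem_range, Nat.lt_succ_iff] at hp
      exact hK b hp.1.1 v hp.2
    · intro k _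
      ext j
      by_cases hj : j = a <;> simp [hj]
    · rintro ⟨b, v⟩ hp
      simp only [Finset.mem_product, Finset.mem_filter] at hp
      refine Prod.ext ?_ (by simp)
      ext j
      by_cases hj : j = a <;> simp [hj, hp.1.2]
    · intro k _
      rw [← Finsupp.add_sum_erase' k a (fun _ v => v) (fun _ => rfl),
        ← Finsupp.mul_prod_erase' k a (fun j v => (Nat.choose (d j) v : ℤ)) (fun _ => by simp),
        pow_add]
      ring
  rw [hbij, Finset.sum_product]
  simp only [← Finset.mul_sum, Int.alternating_sum_range_choose_of_ne ha, mul_zero,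
    Finset.sum_const_zero]


/-- **Vanishing of the Euler characteristic for homogeneity `h = 0`.**
Let `n ≥ 1` and let `w` be any integer.  The set `K` of finitely supported
`k : ℕ → ℕ` with `k 0 = 0`, `k j ≤ C(n−1+j, j)` for all `j ≥ 1`, and
`∑_j (j−2)·(k j) = w` (in `ℤ`) is finite, and
`∑_{k ∈ K} (−1)^{∑_j k j} · ∏_j C(C(n−1+j, j), k j) = 0` in `ℤ`.
Cohomologically: for a 0-homogeneous Poisson structure on `ℝⁿ` the weight-`w` Euler
characteristic `∑_m (−1)^m dim C̄ᵐ_w` vanishes for every weight `w`. -/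
theorem euler_characteristic_zero_h_zero (n : ℕ) (hn : 1 ≤ n) (w : ℤ) :
    ∃ hK : {k : ℕ →₀ ℕ | k 0 = 0 ∧ (∀ j, 1 ≤ j → k j ≤ Nat.choose (n - 1 + j) j) ∧
        (k.sum fun j v => ((j : ℤ) - 2) * v) = w}.Finite,
      ∑ k ∈ hK.toFinset,
        (-1 : ℤ) ^ (k.sum fun _ v => v) *
          (k.prod fun j v => (Nat.choose (Nat.choose (n - 1 + j) j) v : ℤ)) = 0 := by
  refine ⟨finite_bounded_finsupp_of_weight n hn w, ?_⟩
  refine sum_neg_one_pow_mul_prod_choose_eq_zero _ (fun j => Nat.choose (n - 1 + j) j) 2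
    (Nat.choose_pos (by omega)).ne' ?_ ?_
  · intro k hk
    exact ((Set.Finite.mem_toFinset _).1 hk).2.1 2 (by norm_num)
  · intro k hk v hv
    rw [Set.Finite.mem_toFinset] at hk ⊢
    obtain ⟨h0, hd, hw⟩ := hk
    refine ⟨by simpa [Finsupp.update_apply] using h0, fun j hj => ?_, ?_⟩
    · by_cases h : j = 2
      · subst h
        simpa using hv
      · simpa [Finsupp.update_apply, h] using hd j hj
    · rw [← Finsupp.add_sum_erase' (k.update 2 v) 2 _ (by simp), Finsupp.erase_update_eq_erase]
      rw [← Finsupp.add_sum_erase' k 2 _ (by simp)] at hw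
      simpa using hw
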